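/- arXiv:0706.1973 — 4 statements merged into one kernel-verified Lean document; each statement's English description precedes it below -/
import Mathlib

section
/- The quadruple (A1, A2, A3, A4) is a 4-(145; 72, 66, 67, 81; 141) supplementary difference set in Z_145; that is, |A1| = 72, |A2| = 66, |A3| = 67, |A4| = 81, and for every nonzero d ∈ Z_145, the total number of ordered pairs (x, y) with x, y ∈ A_i and x − y = d, summed over i = 1, 2, 3, 4, equals 141. -/
open Finset Matrix

/-- The subgroup H of order 7 of the multiplicative group of `ZMod 145`. -/
def H : Finset (ZMod 145) := {1, 16, 36, 81, 111, 136, 141}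

/-- Representatives of the even-indexed orbits. -/
def rep : List (ZMod 145) := [1, 2, 3, 6, 7, 11, 14, 22, 5, 10, 29, 58]

/-- The orbits `α i`: `α (2*i) = rep[i] • H` and `α (2*i+1) = -α (2*i)`. -/
def alpha (i : ℕ) : Finset (ZMod 145) :=
  if i % 2 = 0 then H.image (fun h => rep.getD (i / 2) 0 * h)
  else (H.image (fun h => rep.getD (i / 2) 0 * h)).image (fun x => -x)

def A1 : Finset (ZMod 145) := ({1, 2, 4, 7, 9, 10, 13, 14, 16, 19, 20, 22} : Finset ℕ).biUnion alpha
def A2 : Finset (ZMod 145) := ({0, 2, 4, 7, 10, 11, 14, 18, 19, 20, 21, 22} : Finset ℕ).biUnion alpha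
def A3 : Finset (ZMod 145) := ({1, 3, 6, 9, 12, 13, 14, 17, 19, 20, 21, 22, 23} : Finset ℕ).biUnion alpha
def A4 : Finset (ZMod 145) := ({2, 3, 5, 6, 7, 9, 12, 13, 15, 16, 19, 20, 21, 22, 23} : Finset ℕ).biUnion alpha

/-- The number of `k < n` such that the bits of `m` at positions `k` and `k + d` modulo `n`
are both set. -/
def cyclicCorrelation (n m d : ℕ) : ℕ :=
  (List.range n).countP fun k => m.testBit k && m.testBit ((k + d) % n)

lemma card_filter_sub_eq_cyclicCorrelation {n : ℕ} [NeZero n] {A : Finset (ZMod n)} {m : ℕ}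
    (hA : ∀ x : ZMod n, x ∈ A ↔ m.testBit x.val = true) (d : ZMod n) :
    ((A ×ˢ A).filter (fun p => p.1 - p.2 = d)).card = cyclicCorrelation n m d.val := by
  have hcount : cyclicCorrelation n m d.val =
      ((Finset.range n).filter fun k =>
        (m.testBit k && m.testBit ((k + d.val) % n)) = true).card := by
    simp only [cyclicCorrelation, List.countP_eq_length_filter, Finset.card_def,
      Finset.filter_val, Finset.range_val, Multiset.range, Multiset.filter_coe,
      Multiset.coe_card, Bool.decide_eq_true]
  rw [hcount]
  refine Finset.card_bij (fun p _ => p.2.val) ?_ ?_ ?_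
  · rintro ⟨x, y⟩ h
    simp only [Finset.mem_filter, Finset.mem_product, sub_eq_iff_eq_add'] at h
    obtain ⟨⟨hx, hy⟩, rfl⟩ := h
    simp only [Finset.mem_filter, Finset.mem_range, Bool.and_eq_true]
    exact ⟨ZMod.val_lt y, (hA y).1 hy, by rw [← ZMod.val_add]; exact (hA _).1 hx⟩
  · rintro ⟨x, y⟩ h ⟨x', y'⟩ h' hy
    simp only [Finset.mem_filter, sub_eq_iff_eq_add'] at h h'
    obtain rfl : y = y' := ZMod.val_injective n hy
    rw [h.2, h'.2]
  · intro k hk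
    simp only [Finset.mem_filter, Finset.mem_range, Bool.and_eq_true] at hk
    have hval : (k : ZMod n).val = k := ZMod.val_cast_of_lt hk.1
    refine ⟨((k : ZMod n) + d, k), ?_, hval⟩
    simp only [Finset.mem_filter, Finset.mem_product, hA, ZMod.val_add, hval,
      add_sub_cancel_left, and_true]
    exact hk.2.symm

/-- The bit mask of `A1`. -/
def maskA1 : ℕ := 23579831101534759513072580534518622313392700

/-- The bit mask of `A2`. -/
def maskA2 : ℕ := 3823609839665890011129782742117883110984718

/-- The bit mask of `A3`. -/
def maskA3 : ℕ := 35242117700903372516339130846979766794085200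

/-- The bit mask of `A4`. -/
def maskA4 : ℕ := 17993423883908222951078322874238521148600676

lemma mem_A1_iff : ∀ x : ZMod 145, x ∈ A1 ↔ maskA1.testBit x.val = true := by
  decide +kernel

lemma mem_A2_iff : ∀ x : ZMod 145, x ∈ A2 ↔ maskA2.testBit x.val = true := by
  decide +kernel

lemma mem_A3_iff : ∀ x : ZMod 145, x ∈ A3 ↔ maskA3.testBit x.val = true := by
  decide +kernel

lemma mem_A4_iff : ∀ x : ZMod 145, x ∈ A4 ↔ maskA4.testBit x.val = true := by
  decide +kernel

lemma sum_cyclicCorrelation_mask : ∀ d < 145, d ≠ 0 →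
    cyclicCorrelation 145 maskA1 d + cyclicCorrelation 145 maskA2 d +
      cyclicCorrelation 145 maskA3 d + cyclicCorrelation 145 maskA4 d = 141 := by
  decide +kernel

theorem sds_A :
    A1.card = 72 ∧ A2.card = 66 ∧ A3.card = 67 ∧ A4.card = 81 ∧
    ∀ d : ZMod 145, d ≠ 0 →
      ((A1 ×ˢ A1).filter (fun p => p.1 - p.2 = d)).card +
      ((A2 ×ˢ A2).filter (fun p => p.1 - p.2 = d)).card +
      ((A3 ×ˢ A3).filter (fun p => p.1 - p.2 = d)).card +
      ((A4 ×ˢ A4).filter (fun p => p.1 - p.2 = d)).card = 141 := by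
  refine ⟨by decide +kernel, by decide +kernel, by decide +kernel, by decide +kernel,
    fun d hd => ?_⟩
  rw [card_filter_sub_eq_cyclicCorrelation mem_A1_iff,
    card_filter_sub_eq_cyclicCorrelation mem_A2_iff,
    card_filter_sub_eq_cyclicCorrelation mem_A3_iff,
    card_filter_sub_eq_cyclicCorrelation mem_A4_iff]
  exact sum_cyclicCorrelation_mask d.val (ZMod.val_lt d) ((ZMod.val_ne_zero d).2 hd)
end

section
/- The quadruple (B1, B2, B3, B4) is a 4-(145; 72, 66, 67, 81; 141) supplementary difference set in Z_145; that is, |B1| = 72, |B2| = 66, |B3| = 67, |B4| = 81, and for every nonzero d ∈ Z_145, the total number of ordered pairs (x, y) with x, y ∈ B_i and x − y = d, summed over i = 1, 2, 3, 4, equals 141. -/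
open Finset Matrix

def B1 : Finset (ZMod 145) := ({1, 3, 5, 7, 8, 10, 13, 15, 17, 18, 20, 23} : Finset ℕ).biUnion alpha
def B2 : Finset (ZMod 145) := ({0, 1, 2, 4, 12, 13, 15, 18, 19, 20, 22, 23} : Finset ℕ).biUnion alpha
def B3 : Finset (ZMod 145) := ({4, 5, 6, 7, 9, 12, 14, 16, 18, 20, 21, 22, 23} : Finset ℕ).biUnion alpha
def B4 : Finset (ZMod 145) := ({2, 6, 9, 10, 11, 12, 13, 14, 15, 17, 18, 20, 21, 22, 23} : Finset ℕ).biUnion alpha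

/-- The number of pairs in `B` with difference `d` counts the `x ∈ B` with `x - d ∈ B`. -/
theorem card_filter_sub_eq {G : Type*} [AddCommGroup G] [DecidableEq G] (B : Finset G) (d : G) :
    ((B ×ˢ B).filter (fun p => p.1 - p.2 = d)).card = (B.filter (fun x => x - d ∈ B)).card := by
  refine Finset.card_bij' (fun p _ => p.1) (fun x _ => (x, x - d)) ?_ ?_ ?_ ?_
  · rintro ⟨x, y⟩ h
    simp only [mem_filter, mem_product] at h ⊢
    obtain ⟨⟨hx, hy⟩, rfl⟩ := h
    simpa using ⟨hx, hy⟩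
  · intro x h
    simp only [mem_filter, mem_product] at h ⊢
    exact ⟨h, sub_sub_cancel x d⟩
  · rintro ⟨x, y⟩ h
    simp only [mem_filter] at h
    obtain ⟨-, rfl⟩ := h
    simp
  · intro x _
    rfl

/-- The number of `x < 145` such that both `x` and `x - d` modulo 145 are bits of the mask `m`. -/
def maskCorrelation (m d : ℕ) : ℕ :=
  (List.range 145).countP fun x => m.testBit x && m.testBit ((x + (145 - d)) % 145)

/-- Pair counts of a subset of `ZMod 145` can be read off a bit mask representing the subset. -/
theorem card_filter_sub_eq_maskCorrelation {B : Finset (ZMod 145)} {m : ℕ}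
    (hB : ∀ x : ZMod 145, x ∈ B ↔ m.testBit x.val = true) (d : ZMod 145) :
    ((B ×ˢ B).filter (fun p => p.1 - p.2 = d)).card = maskCorrelation m d.val := by
  have hval (x : ℕ) : ((x : ZMod 145) - d).val = (x + (145 - d.val)) % 145 := by
    rw [← ZMod.val_natCast]
    congr 1
    rw [Nat.cast_add, Nat.cast_sub d.val_le, ZMod.natCast_self, ZMod.natCast_zmod_val]
    ring
  have hcount : maskCorrelation m d.val = ((Finset.range 145).filter fun x =>
      (m.testBit x && m.testBit ((x + (145 - d.val)) % 145)) = true).card := by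
    rw [maskCorrelation, List.countP_eq_length_filter]
    simp only [Finset.card_def, Finset.filter_val, Finset.range_val, Multiset.range,
      Multiset.filter_coe, Multiset.coe_card, Bool.decide_eq_true]
  rw [card_filter_sub_eq, hcount]
  refine Finset.card_bij' (fun x _ => x.val) (fun x _ => (x : ZMod 145)) ?_ ?_ ?_ ?_
  · intro x h
    simp only [mem_filter, hB] at h
    simpa [← hval, ZMod.val_lt] using h
  · intro x h
    simp only [mem_filter, Finset.mem_range, Bool.and_eq_true] at h
    simpa only [mem_filter, hB, hval, ZMod.val_natCast, Nat.mod_eq_of_lt h.1] using h.2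
  · intro x _
    exact ZMod.natCast_zmod_val x
  · intro x h
    exact ZMod.val_cast_of_lt (Finset.mem_range.mp (mem_filter.mp h).1)

/-- The bit mask of `B1`. -/
def mask1 : ℕ := 41126282472092818878461583139504756889001872

theorem mem_B1_iff (x : ZMod 145) : x ∈ B1 ↔ mask1.testBit x.val = true := by
  revert x
  decide +kernel

/-- The bit mask of `B2`. -/
def mask2 : ℕ := 25409151184147680312348648425768644667754014

theorem mem_B2_iff (x : ZMod 145) : x ∈ B2 ↔ mask2.testBit x.val = true := by
  revert x
  decide +kernel

/-- The bit mask of `B3`. -/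
def mask3 : ℕ := 6631475728375542107712589767199312277206120

theorem mem_B3_iff (x : ZMod 145) : x ∈ B3 ↔ mask3.testBit x.val = true := by
  revert x
  decide +kernel

/-- The bit mask of `B4`. -/
def mask4 : ℕ := 1941266479445531126050478897764825722186820

theorem mem_B4_iff (x : ZMod 145) : x ∈ B4 ↔ mask4.testBit x.val = true := by
  revert x
  decide +kernel

theorem maskCorrelation_sum : ∀ d < 145, d ≠ 0 →
    maskCorrelation mask1 d + maskCorrelation mask2 d + maskCorrelation mask3 d +
      maskCorrelation mask4 d = 141 := by
  decide +kernel

theorem sds_B :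
    B1.card = 72 ∧ B2.card = 66 ∧ B3.card = 67 ∧ B4.card = 81 ∧
    ∀ d : ZMod 145, d ≠ 0 →
      ((B1 ×ˢ B1).filter (fun p => p.1 - p.2 = d)).card +
      ((B2 ×ˢ B2).filter (fun p => p.1 - p.2 = d)).card +
      ((B3 ×ˢ B3).filter (fun p => p.1 - p.2 = d)).card +
      ((B4 ×ˢ B4).filter (fun p => p.1 - p.2 = d)).card = 141 := by
  refine ⟨by decide +kernel, by decide +kernel, by decide +kernel, by decide +kernel, ?_⟩
  intro d hd
  rw [card_filter_sub_eq_maskCorrelation mem_B1_iff, card_filter_sub_eq_maskCorrelation mem_B2_iff,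
    card_filter_sub_eq_maskCorrelation mem_B3_iff, card_filter_sub_eq_maskCorrelation mem_B4_iff]
  exact maskCorrelation_sum d.val d.val_lt ((ZMod.val_ne_zero d).mpr hd)
end

section
/- The 580 × 580 matrix GS([B1], [B2], [B3], [B4]) built by substituting the circulant matrices [B1], [B2], [B3], [B4] into the Goethals–Seidel array is a skew-Hadamard matrix of order 580; that is, all its entries are ±1, it satisfies M · Mᵀ = 580 · I_580, and M + Mᵀ = 2 · I_580. -/
open Finset Matrix

/-- The circulant {±1}-matrix `[X]` associated to `X ⊆ ZMod 145`. -/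
def circ (X : Finset (ZMod 145)) : Matrix (ZMod 145) (ZMod 145) ℤ :=
  Matrix.of fun i j => if j - i ∈ X then -1 else 1

/-- The back-diagonal permutation matrix `R`. -/
def R : Matrix (ZMod 145) (ZMod 145) ℤ :=
  Matrix.of fun i j => if i + j = (144 : ZMod 145) then 1 else 0

/-- The Goethals–Seidel array. -/
def GS (P1 P2 P3 P4 : Matrix (ZMod 145) (ZMod 145) ℤ) :
    Matrix (Fin 4 × ZMod 145) (Fin 4 × ZMod 145) ℤ :=
  Matrix.of fun p q =>
    (![![P1, P2 * R, P3 * R, P4 * R],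
       ![-(P2 * R), P1, -(P4ᵀ * R), P3ᵀ * R],
       ![-(P3 * R), P4ᵀ * R, P1, -(P2ᵀ * R)],
       ![-(P4 * R), -(P3ᵀ * R), P2ᵀ * R, P1]] p.1 q.1) p.2 q.2

theorem R_transpose : Rᵀ = R := by
  ext i j
  simp [R, add_comm]

theorem mul_R_apply (P : Matrix (ZMod 145) (ZMod 145) ℤ) (i j : ZMod 145) :
    (P * R) i j = P i (144 - j) := by
  simp [R, mul_apply, ← eq_sub_iff_add_eq]

theorem R_mul_apply (P : Matrix (ZMod 145) (ZMod 145) ℤ) (i j : ZMod 145) :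
    (R * P) i j = P (144 - i) j := by
  simp [R, mul_apply, ← eq_sub_iff_add_eq']

theorem R_mul_R : R * R = 1 := by
  ext i j
  rw [mul_R_apply, R, of_apply, ← add_sub_assoc, add_comm i, add_sub_assoc]
  simp [one_apply, sub_eq_zero]

theorem R_mul_circulant (v : ZMod 145 → ℤ) :
    R * circulant v = circulant (fun x => v (-x)) * R := by
  ext i j
  rw [R_mul_apply, mul_R_apply, circulant_apply, circulant_apply]
  congr 1
  ring

theorem circulant_mul_R_symm (v : ZMod 145 → ℤ) : (circulant v * R)ᵀ = circulant v * R := by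
  rw [transpose_mul, R_transpose, transpose_circulant, R_mul_circulant]
  simp

/-- The block of the Goethals–Seidel array in position `(a, b)`. -/
def GSBlock (P1 P2 P3 P4 : Matrix (ZMod 145) (ZMod 145) ℤ) (a b : Fin 4) :
    Matrix (ZMod 145) (ZMod 145) ℤ :=
  of fun i j => GS P1 P2 P3 P4 (a, i) (b, j)

theorem GSBlock_eq (P1 P2 P3 P4 : Matrix (ZMod 145) (ZMod 145) ℤ) (a b : Fin 4) :
    GSBlock P1 P2 P3 P4 a b =
      ![![P1, P2 * R, P3 * R, P4 * R],
        ![-(P2 * R), P1, -(P4ᵀ * R), P3ᵀ * R],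
        ![-(P3 * R), P4ᵀ * R, P1, -(P2ᵀ * R)],
        ![-(P4 * R), -(P3ᵀ * R), P2ᵀ * R, P1]] a b :=
  rfl

theorem GS_mul_transpose_apply (P1 P2 P3 P4 : Matrix (ZMod 145) (ZMod 145) ℤ)
    (p q : Fin 4 × ZMod 145) :
    (GS P1 P2 P3 P4 * (GS P1 P2 P3 P4)ᵀ) p q =
      (∑ c, GSBlock P1 P2 P3 P4 p.1 c * (GSBlock P1 P2 P3 P4 q.1 c)ᵀ) p.2 q.2 := by
  simp only [mul_apply, Fintype.sum_prod_type, Matrix.sum_apply, GSBlock, of_apply, transpose_apply]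

theorem GSBlock_circulant_mul (v1 v2 v3 v4 : ZMod 145 → ℤ) (a b : Fin 4) :
    ∑ c, GSBlock (circulant v1) (circulant v2) (circulant v3) (circulant v4) a c *
      (GSBlock (circulant v1) (circulant v2) (circulant v3) (circulant v4) b c)ᵀ =
    if a = b then circulant v1 * (circulant v1)ᵀ + circulant v2 * (circulant v2)ᵀ +
      circulant v3 * (circulant v3)ᵀ + circulant v4 * (circulant v4)ᵀ else 0 := by
  have R_mul_circulant_mul (v : ZMod 145 → ℤ) (A : Matrix (ZMod 145) (ZMod 145) ℤ) :
      R * (circulant v * A) = circulant (fun x => v (-x)) * (R * A) := by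
    rw [← mul_assoc, R_mul_circulant, mul_assoc]
  have comm (v w : ZMod 145 → ℤ) := circulant_mul_comm v w
  have left_comm (v w : ZMod 145 → ℤ) (A : Matrix (ZMod 145) (ZMod 145) ℤ) :
      circulant v * (circulant w * A) = circulant w * (circulant v * A) := by
    rw [← mul_assoc, circulant_mul_comm, mul_assoc]
  fin_cases a <;> fin_cases b <;>
    simp [Fin.sum_univ_four, GSBlock_eq, transpose_circulant, R_transpose, mul_assoc,
      R_mul_circulant, R_mul_circulant_mul, R_mul_R] <;>
    simp only [comm, left_comm] <;> abel

theorem GS_circulant_mul_transpose {v1 v2 v3 v4 : ZMod 145 → ℤ} {m : ℤ}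
    (h : circulant v1 * (circulant v1)ᵀ + circulant v2 * (circulant v2)ᵀ +
      circulant v3 * (circulant v3)ᵀ + circulant v4 * (circulant v4)ᵀ = m • 1) :
    GS (circulant v1) (circulant v2) (circulant v3) (circulant v4) *
      (GS (circulant v1) (circulant v2) (circulant v3) (circulant v4))ᵀ = m • 1 := by
  ext ⟨a, i⟩ ⟨b, j⟩
  rw [GS_mul_transpose_apply, GSBlock_circulant_mul, h]
  by_cases hab : a = b <;> simp [hab, one_apply]

theorem GS_circulant_add_transpose {v1 v2 v3 v4 : ZMod 145 → ℤ} {m : ℤ}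
    (h : circulant v1 + (circulant v1)ᵀ = m • 1) :
    GS (circulant v1) (circulant v2) (circulant v3) (circulant v4) +
      (GS (circulant v1) (circulant v2) (circulant v3) (circulant v4))ᵀ = m • 1 := by
  have block (a b : Fin 4) :
      GSBlock (circulant v1) (circulant v2) (circulant v3) (circulant v4) a b +
        (GSBlock (circulant v1) (circulant v2) (circulant v3) (circulant v4) b a)ᵀ =
      if a = b then m • 1 else 0 := by
    simp only [GSBlock_eq, transpose_circulant]
    fin_cases a <;> fin_cases b <;> simp [circulant_mul_R_symm, -transpose_mul, h]
  ext ⟨a, i⟩ ⟨b, j⟩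
  refine (congrFun₂ (block a b) i j).trans ?_
  by_cases hab : a = b <;> simp [hab, one_apply]

/-- All entries of `P` are `1` or `-1`. -/
def IsSignMatrix (P : Matrix (ZMod 145) (ZMod 145) ℤ) : Prop := ∀ i j, P i j = 1 ∨ P i j = -1

theorem IsSignMatrix.neg {P : Matrix (ZMod 145) (ZMod 145) ℤ} (h : IsSignMatrix P) :
    IsSignMatrix (-P) := fun i j => by
  rw [Matrix.neg_apply, neg_inj, neg_eq_iff_eq_neg]
  exact (h i j).symm

theorem IsSignMatrix.transpose {P : Matrix (ZMod 145) (ZMod 145) ℤ} (h : IsSignMatrix P) :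
    IsSignMatrix Pᵀ := fun i j => h j i

theorem IsSignMatrix.mul_R {P : Matrix (ZMod 145) (ZMod 145) ℤ} (h : IsSignMatrix P) :
    IsSignMatrix (P * R) := fun i j => by
  rw [mul_R_apply]
  exact h _ _

theorem GS_apply_eq_one_or {P1 P2 P3 P4 : Matrix (ZMod 145) (ZMod 145) ℤ}
    (h1 : IsSignMatrix P1) (h2 : IsSignMatrix P2) (h3 : IsSignMatrix P3) (h4 : IsSignMatrix P4)
    (p q : Fin 4 × ZMod 145) : GS P1 P2 P3 P4 p q = 1 ∨ GS P1 P2 P3 P4 p q = -1 := by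
  have block (a b : Fin 4) : IsSignMatrix (GSBlock P1 P2 P3 P4 a b) := by
    rw [GSBlock_eq]
    fin_cases a <;> fin_cases b <;>
      simp [h1, h2.mul_R, h3.mul_R, h4.mul_R, h2.transpose.mul_R, h3.transpose.mul_R,
        h4.transpose.mul_R, IsSignMatrix.neg]
  exact block p.1 q.1 p.2 q.2

/-- The sign function of `X`, equal to `-1` on `X` and to `1` elsewhere. -/
def sign (X : Finset (ZMod 145)) (x : ZMod 145) : ℤ := if x ∈ X then -1 else 1

theorem circ_eq_circulant (X : Finset (ZMod 145)) : circ X = circulant fun x => sign X (-x) := by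
  ext i j
  simp [circ, sign]

theorem isSignMatrix_circ (X : Finset (ZMod 145)) : IsSignMatrix (circ X) := fun i j => by
  rw [circ, of_apply]
  split_ifs <;> simp

/-- The periodic autocorrelation of `v`. -/
def autocorr (v : ZMod 145 → ℤ) (s : ZMod 145) : ℤ := ∑ y, v y * v (y + s)

theorem circ_mul_transpose_apply (X : Finset (ZMod 145)) (i j : ZMod 145) :
    (circ X * (circ X)ᵀ) i j = autocorr (sign X) (i - j) := by
  rw [mul_apply, autocorr]
  refine Fintype.sum_equiv (Equiv.subRight i) _ _ fun k => ?_
  simp [circ, sign]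

theorem autocorr_neg (v : ZMod 145 → ℤ) (s : ZMod 145) : autocorr v (-s) = autocorr v s := by
  refine Fintype.sum_equiv (Equiv.subRight s) _ _ fun y => ?_
  simp [mul_comm, sub_eq_add_neg]

theorem autocorr_mul {v : ZMod 145 → ℤ} {h : ZMod 145} (hu : IsUnit h)
    (hv : ∀ x, v (h * x) = v x) (s : ZMod 145) : autocorr v (h * s) = autocorr v s := by
  refine (Fintype.sum_equiv (Units.mulLeft hu.unit) _ _ fun y => ?_).symm
  simp [← mul_add, hv]

/-- The sign vector of length 145 with `-1` at the positions of the binary digits `1` of `m`. -/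
def bitSign (m : ℕ) (x : ZMod 145) : ℤ := if m.testBit x.val then -1 else 1

theorem sign_B1 : sign B1 = bitSign mask1 := funext (by decide +kernel)

theorem sign_B2 : sign B2 = bitSign mask2 := funext (by decide +kernel)

theorem sign_B3 : sign B3 = bitSign mask3 := funext (by decide +kernel)

theorem sign_B4 : sign B4 = bitSign mask4 := funext (by decide +kernel)

theorem isUnit_of_mem_H {h : ZMod 145} (hh : h ∈ H) : IsUnit h := by
  have : ∀ h ∈ H, h ^ 7 = 1 := by decide +kernel
  exact IsUnit.of_pow_eq_one (this h hh) (by norm_num)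

theorem bitSign_H_mul : ∀ h ∈ H, ∀ x, bitSign mask1 (h * x) = bitSign mask1 x ∧
    bitSign mask2 (h * x) = bitSign mask2 x ∧ bitSign mask3 (h * x) = bitSign mask3 x ∧
    bitSign mask4 (h * x) = bitSign mask4 x := by
  decide +kernel

theorem exists_rep : ∀ s : ZMod 145, s ≠ 0 →
    ∃ r ∈ rep, ∃ h ∈ H, s = h * r ∨ s = -(h * r) := by
  decide +kernel

/-- The sum of the periodic autocorrelations of the sign vectors of the four sets. -/
def autocorrSum (s : ZMod 145) : ℤ :=
  autocorr (bitSign mask1) s + autocorr (bitSign mask2) s +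
    autocorr (bitSign mask3) s + autocorr (bitSign mask4) s

theorem autocorrSum_rep : autocorrSum 0 = 580 ∧ ∀ r ∈ rep, autocorrSum r = 0 := by
  decide +kernel

theorem autocorrSum_neg (s : ZMod 145) : autocorrSum (-s) = autocorrSum s := by
  simp only [autocorrSum, autocorr_neg]

theorem autocorrSum_H_mul {h : ZMod 145} (hh : h ∈ H) (s : ZMod 145) :
    autocorrSum (h * s) = autocorrSum s := by
  have hu := isUnit_of_mem_H hh
  have hv := bitSign_H_mul h hh
  rw [autocorrSum, autocorr_mul hu fun x => (hv x).1, autocorr_mul hu fun x => (hv x).2.1,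
    autocorr_mul hu fun x => (hv x).2.2.1, autocorr_mul hu fun x => (hv x).2.2.2, autocorrSum]

theorem autocorrSum_eq (s : ZMod 145) : autocorrSum s = if s = 0 then 580 else 0 := by
  split_ifs with hs
  · rw [hs, autocorrSum_rep.1]
  · obtain ⟨r, hr, h, hh, rfl | rfl⟩ := exists_rep s hs
    · rw [autocorrSum_H_mul hh, autocorrSum_rep.2 r hr]
    · rw [autocorrSum_neg, autocorrSum_H_mul hh, autocorrSum_rep.2 r hr]

theorem circ_mul_transpose_sum :
    circ B1 * (circ B1)ᵀ + circ B2 * (circ B2)ᵀ + circ B3 * (circ B3)ᵀ + circ B4 * (circ B4)ᵀ =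
      (580 : ℤ) • 1 := by
  ext i j
  have := autocorrSum_eq (i - j)
  simp only [Matrix.add_apply, circ_mul_transpose_apply, sign_B1, sign_B2, sign_B3, sign_B4]
  rw [← autocorrSum, this]
  simp [one_apply, sub_eq_zero]

theorem circ_B1_add_transpose : circ B1 + (circ B1)ᵀ = (2 : ℤ) • 1 := by
  have skew : ∀ x, bitSign mask1 x + bitSign mask1 (-x) = if x = 0 then 2 else 0 := by
    decide +kernel
  ext i j
  have := skew (j - i)
  rw [circ_eq_circulant, sign_B1]
  simpa [one_apply, sub_eq_zero, eq_comm] using this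

theorem gs_skew_hadamard_B :
    (∀ p q, GS (circ B1) (circ B2) (circ B3) (circ B4) p q = 1 ∨
            GS (circ B1) (circ B2) (circ B3) (circ B4) p q = -1) ∧
    GS (circ B1) (circ B2) (circ B3) (circ B4) *
      (GS (circ B1) (circ B2) (circ B3) (circ B4))ᵀ = (580 : ℤ) • 1 ∧
    GS (circ B1) (circ B2) (circ B3) (circ B4) +
      (GS (circ B1) (circ B2) (circ B3) (circ B4))ᵀ = (2 : ℤ) • 1 := by
  refine ⟨GS_apply_eq_one_or (isSignMatrix_circ B1) (isSignMatrix_circ B2)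
    (isSignMatrix_circ B3) (isSignMatrix_circ B4), ?_, ?_⟩
  · have h := circ_mul_transpose_sum
    simp only [circ_eq_circulant] at h ⊢
    exact GS_circulant_mul_transpose h
  · have h := circ_B1_add_transpose
    simp only [circ_eq_circulant] at h ⊢
    exact GS_circulant_add_transpose h
end

section
/- The sets A2 and B2 in Z_145 are not equivalent under translations and multiplications by invertible elements; that is, there do not exist a unit a ∈ Z_145 and an element b ∈ Z_145 such that {a · x + b : x ∈ A2} = B2. -/
open Finset Matrix

/-- The number of elements `x ∈ S` such that `x + d ∈ S`. -/
def autocorrelation {R : Type*} [Add R] [DecidableEq R] (S : Finset R) (d : R) : ℕ :=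
  (S.filter (fun x => x + d ∈ S)).card

theorem autocorrelation_image_affine {R : Type*} [CommRing R] [DecidableEq R]
    (S : Finset R) (a : Rˣ) (b d : R) :
    autocorrelation (S.image (fun x => (a : R) * x + b)) (a * d) = autocorrelation S d := by
  have hinj : Function.Injective (fun x : R => (a : R) * x + b) := fun x y h =>
    a.isUnit.mul_left_cancel (add_right_cancel h)
  have hshift (x : R) : (a : R) * x + b + a * d = (fun x : R => (a : R) * x + b) (x + d) := by
    ring
  simp only [autocorrelation, filter_image, hshift, hinj.mem_finset_image]
  exact card_image_of_injective _ hinj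

theorem autocorrelation_A2_one : autocorrelation A2 1 = 27 := by
  decide +kernel

theorem image_sixteen_mul_B2 : B2.image (fun x => 16 * x) = B2 := by
  decide +kernel

theorem autocorrelation_B2_sixteen_pow_mul (k : ℕ) (d : ZMod 145) :
    autocorrelation B2 (16 ^ k * d) = autocorrelation B2 d := by
  induction k with
  | zero => simp
  | succ k ih =>
    have h := autocorrelation_image_affine B2
      (Units.mkOfMulEqOne (16 : ZMod 145) 136 (by decide)) 0 (16 ^ k * d)
    simp only [Units.val_mkOfMulEqOne, add_zero, image_sixteen_mul_B2] at h
    rw [pow_succ', mul_assoc, h, ih]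

/-- Representatives of the cosets of `H` in the unit group of `ZMod 145`. -/
def unitCosetReps : Finset (ZMod 145) :=
  {1, 2, 3, 4, 6, 7, 8, 11, 12, 13, 14, 22, 23, 24, 26, 39}

theorem exists_sixteen_pow_mul_mem_unitCosetReps :
    ∀ d : ZMod 145, d.val.Coprime 145 → ∃ k : Fin 7, 16 ^ (k : ℕ) * d ∈ unitCosetReps := by
  decide +kernel

theorem autocorrelation_B2_ne_of_mem_unitCosetReps :
    ∀ d ∈ unitCosetReps, autocorrelation B2 d ≠ 27 := by
  decide +kernel

theorem not_equivalent :
    ¬ ∃ (a : (ZMod 145)ˣ) (b : ZMod 145),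
        A2.image (fun x => (a : ZMod 145) * x + b) = B2 := by
  rintro ⟨a, b, h⟩
  obtain ⟨k, hk⟩ := exists_sixteen_pow_mul_mem_unitCosetReps a (ZMod.val_coe_unit_coprime a)
  apply autocorrelation_B2_ne_of_mem_unitCosetReps _ hk
  have key := autocorrelation_image_affine A2 a b 1
  rw [h, mul_one, autocorrelation_A2_one] at key
  rw [autocorrelation_B2_sixteen_pow_mul, key]
end
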